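/- Let R be a commutative ring, r ≥ 1, and let a_1, …, a_{r+1} ∈ R be such that a_{r+1} is a unit of R. Set ξ = a_1 ẽ_1 + ⋯ + a_{r+1} ẽ_{r+1} ∈ Λ(R^{r+1}). Then for every c : {1, …, r+1} → R, if ξ ∧ (c_1 ẽ_1 + ⋯ + c_{r+1} ẽ_{r+1}) ∈ I_P(r), then there exists t ∈ R with c_i = t·a_i for all i. (Equivalently, the first cohomology of the Aomoto complex of the almost parallel arrangement P_r with respect to ξ vanishes: H¹(A_R(P_r), ξ) = 0.) -/

import Mathlib

noncomputable section

/-- The image `ẽ_i` of the `i`-th standard basis vector of `R^m` in `Λ(R^m)`. -/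
def gen (R : Type*) [CommRing R] (m : ℕ) (i : Fin m) :
    ExteriorAlgebra R (Fin m → R) :=
  ExteriorAlgebra.ι R (Pi.single i 1)

/-- Generators of the Orlik-Solomon ideal of the almost parallel arrangement `P_r`
of `r` parallel lines (the first `r` indices) together with one transversal line
(the last index) in `ℂ²`. -/
def parallelGens (R : Type*) [CommRing R] (r : ℕ) :
    Set (ExteriorAlgebra R (Fin (r + 1) → R)) :=
  {x | ∃ u v : Fin (r + 1), u < v ∧ (v : ℕ) < r ∧ x = gen R (r + 1) u * gen R (r + 1) v}

/-- The Orlik-Solomon ideal `I_P(r)` of the almost parallel arrangement `P_r`. -/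
def parallelIdeal (R : Type*) [CommRing R] (r : ℕ) :
    TwoSidedIdeal (ExteriorAlgebra R (Fin (r + 1) → R)) :=
  TwoSidedIdeal.span (parallelGens R r)

theorem ExteriorAlgebra.det_eq_zero_of_ι_mul_ι_eq_zero {R : Type*} [CommRing R] {x y : Fin 2 → R}
    (h : ExteriorAlgebra.ι R x * ExteriorAlgebra.ι R y = 0) : x 0 * y 1 - x 1 * y 0 = 0 := by
  have hι : ExteriorAlgebra.ιMulti R 2 ![x, y] = 0 := by
    simpa [ExteriorAlgebra.ιMulti_apply] using h
  have hdet := ExteriorAlgebra.liftAlternating_apply_ιMulti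
    (Function.update (0 : ∀ n, (Fin 2 → R) [⋀^Fin n]→ₗ[R] R) 2 Matrix.detRowAlternating) ![x, y]
  rw [hι, map_zero, Function.update_self] at hdet
  change 0 = Matrix.det (Matrix.of ![x, y]) at hdet
  simpa [Matrix.det_fin_two] using hdet.symm

theorem sum_smul_gen {R : Type*} [CommRing R] {m : ℕ} (a : Fin m → R) :
    ∑ i, a i • gen R m i = ExteriorAlgebra.ι R a := by
  simp_rw [gen, ← map_smul, ← map_sum]
  congr 1
  exact (pi_eq_sum_univ' a).symm

/-- The projection of `R^{r+1}` onto its `i`-th and last coordinates. -/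
def projLast (R : Type*) [CommRing R] {r : ℕ} (i : Fin (r + 1)) :
    (Fin (r + 1) → R) →ₗ[R] (Fin 2 → R) :=
  LinearMap.pi ![LinearMap.proj i, LinearMap.proj (Fin.last r)]

theorem projLast_apply {R : Type*} [CommRing R] {r : ℕ} (i : Fin (r + 1)) (x : Fin (r + 1) → R) :
    projLast R i x = ![x i, x (Fin.last r)] := by
  ext j
  fin_cases j <;> rfl

theorem map_projLast_eq_zero_of_mem_parallelIdeal {R : Type*} [CommRing R] {r : ℕ}
    (i : Fin (r + 1)) {x : ExteriorAlgebra R (Fin (r + 1) → R)} (hx : x ∈ parallelIdeal R r) :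
    ExteriorAlgebra.map (projLast R i) x = 0 := by
  suffices h : parallelIdeal R r ≤ TwoSidedIdeal.ker (ExteriorAlgebra.map (projLast R i)) from
    (TwoSidedIdeal.mem_ker _).1 (h hx)
  refine TwoSidedIdeal.span_le.2 ?_
  rintro _ ⟨u, v, huv, hv, rfl⟩
  have key (w : Fin (r + 1)) (hw : (w : ℕ) < r) :
      projLast R i (Pi.single w 1) = (Pi.single w (1 : R) : Fin (r + 1) → R) i • ![1, 0] := by
    have hne : Fin.last r ≠ w := fun h => by simp [← h] at hw
    simp [projLast_apply, Pi.single_eq_of_ne hne]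
  rw [SetLike.mem_coe, TwoSidedIdeal.mem_ker, map_mul, gen, gen, ExteriorAlgebra.map_apply_ι,
    ExteriorAlgebra.map_apply_ι, key u (lt_trans huv hv), key v hv, map_smul, map_smul,
    smul_mul_smul_comm, ExteriorAlgebra.ι_sq_zero, smul_zero]

/-- Proposition 2.3 of the paper. If the coefficient `a_{r+1}` of
the transversal line in `ξ = Σ a_i ẽ_i` is a unit, then the first Aomoto cohomology
of the almost parallel arrangement `P_r` vanishes: any `η = Σ c_i ẽ_i` with
`ξ ∧ η ∈ I_P(r)` is a multiple of `ξ`. -/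
theorem parallel_aomoto_vanishing
    (R : Type*) [CommRing R] {r : ℕ} (hr : 1 ≤ r)
    (a : Fin (r + 1) → R) (ha : IsUnit (a (Fin.last r))) (c : Fin (r + 1) → R)
    (hker : (∑ i, a i • gen R (r + 1) i) * (∑ i, c i • gen R (r + 1) i) ∈
      parallelIdeal R r) :
    ∃ t : R, ∀ i, c i = t * a i := by
  have hminor (i : Fin (r + 1)) : a i * c (Fin.last r) - a (Fin.last r) * c i = 0 := by
    have h := map_projLast_eq_zero_of_mem_parallelIdeal i hker
    rw [sum_smul_gen, sum_smul_gen, map_mul, ExteriorAlgebra.map_apply_ι,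
      ExteriorAlgebra.map_apply_ι, projLast_apply, projLast_apply] at h
    simpa using ExteriorAlgebra.det_eq_zero_of_ι_mul_ι_eq_zero h
  obtain ⟨b, hb⟩ := ha.exists_left_inv
  exact ⟨b * c (Fin.last r), fun i => by linear_combination (-c i) * hb - b * hminor i⟩
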